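/- For any r ≥ 2 and α ∈ {1,...,r−1}, writing ζ = e^{2πi/r}, the following identity of formal Laurent coefficients holds: (1/πi) ∑_{i=1}^n [ ζ^{α/2}(1−ζ^α)^{−2g} / ∏_{j≠i}(z_i − z_j)(ζ^α z_i − z_j) − ζ^{−α/2}(1−ζ^{−α})^{−2g} / ∏_{j≠i}(z_i − z_j)(ζ^{−α} z_i − z_j) ] · z_i^{−(r+1)(2g−2+n)+n−2} = (−1)^{g−1+αn} · 2^n / (2π sin(απ/r)) · (2 sin(απ/r))^{−(2g−2+n)} · ∑_{k_1+⋯+k_n = (r+1)(2g−2+n), k_i ≥ 0} ∏_{i=1}^n sin(α k_i π / r) / z_i^{k_i+1}. -/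

import Mathlib

open Finset Complex

theorem PowerSeries.mk_inv_pow_succ_mul_X_sub_C {K : Type*} [Field K] {y : K} (hy : y ≠ 0) :
    (PowerSeries.mk fun k => (y⁻¹) ^ (k + 1)) * (PowerSeries.X - PowerSeries.C y) = -1 := by
  have h := PowerSeries.invUnitsSub_mul_sub (Units.mk0 y hy)
  have h' : PowerSeries.invUnitsSub (Units.mk0 y hy) = PowerSeries.mk fun k => (y⁻¹) ^ (k + 1) := by
    ext k
    simp [PowerSeries.invUnitsSub]
  rw [← h', ← neg_sub, mul_neg]
  simpa using h

/-- Partial fractions for the reciprocal of a product of distinct linear factors. -/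
theorem PowerSeries.sum_partialFractions_mul_prod {K ι : Type*} [Field K] [Fintype ι]
    [DecidableEq ι] [Nonempty ι] {y : ι → K} (hy : ∀ a, y a ≠ 0) (hinj : Function.Injective y) :
    (∑ a, PowerSeries.C (-∏ b ∈ univ.erase a, (y a - y b)⁻¹) *
        PowerSeries.mk fun k => ((y a)⁻¹) ^ (k + 1)) *
      ∏ a, (PowerSeries.X - PowerSeries.C (y a)) = 1 := by
  have h := congrArg (Polynomial.toPowerSeries (R := K))
    (Lagrange.sum_basis (s := univ) (v := y) hinj.injOn univ_nonempty)
  rw [Polynomial.coe_one] at h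
  rw [← h, Finset.sum_mul, ← Polynomial.coeToPowerSeries.ringHom_apply, map_sum]
  refine Finset.sum_congr rfl fun a _ => ?_
  rw [← Finset.mul_prod_erase univ _ (mem_univ a)]
  calc _ = PowerSeries.C (-∏ b ∈ univ.erase a, (y a - y b)⁻¹) *
        ((PowerSeries.mk fun k => ((y a)⁻¹) ^ (k + 1)) * (PowerSeries.X - PowerSeries.C (y a))) *
        ∏ b ∈ univ.erase a, (PowerSeries.X - PowerSeries.C (y b)) := by ring
    _ = _ := by
      rw [PowerSeries.mk_inv_pow_succ_mul_X_sub_C (hy a), Lagrange.basis, map_prod]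
      simp only [Lagrange.basisDivisor, map_mul, map_sub, Polynomial.coeToPowerSeries.ringHom_apply,
        Polynomial.coe_C, Polynomial.coe_X, Finset.prod_mul_distrib, map_neg, map_prod]
      ring

theorem PowerSeries.coeff_prod_mk_fin {R : Type*} [CommSemiring R] {n : ℕ} (f : Fin n → ℕ → R)
    (N : ℕ) :
    PowerSeries.coeff N (∏ i, PowerSeries.mk (f i)) =
      ∑ k ∈ Finset.filter (fun k => ∑ i, k i = N)
          (Fintype.piFinset fun _ : Fin n => Finset.range (N + 1)), ∏ i, f i (k i) := by
  rw [PowerSeries.coeff_prod]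
  refine Finset.sum_bij' (fun l _ => (l : Fin n → ℕ)) (fun k _ => Finsupp.equivFunOnFinite.symm k)
    ?_ ?_ ?_ ?_ ?_
  · intro l hl
    simp only [mem_finsuppAntidiag] at hl
    simp only [mem_filter, Fintype.mem_piFinset, mem_range]
    refine ⟨fun i => Nat.lt_succ_of_le ?_, hl.1⟩
    rw [← hl.1]
    exact Finset.single_le_sum (f := fun i => l i) (fun _ _ => Nat.zero_le _) (mem_univ i)
  · intro k hk
    simp only [mem_filter] at hk
    simp [mem_finsuppAntidiag, hk.2]
  · intro l _; ext; simp
  · intro k _; ext; simp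
  · intro l _; simp

theorem PowerSeries.mk_sub_inv_mul {K : Type*} [Field K] {w z : K} (hw : w ≠ 0) (hz : z ≠ 0) :
    (PowerSeries.mk fun k => (w ^ k - (w⁻¹) ^ k) / z ^ (k + 1)) *
      ((PowerSeries.X - PowerSeries.C (z * w⁻¹)) * (PowerSeries.X - PowerSeries.C (z * w))) =
      PowerSeries.C (w - w⁻¹) * PowerSeries.X := by
  have h₁ := PowerSeries.mk_inv_pow_succ_mul_X_sub_C (mul_ne_zero hz (inv_ne_zero hw))
  have h₂ := PowerSeries.mk_inv_pow_succ_mul_X_sub_C (mul_ne_zero hz hw)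
  have h : (PowerSeries.mk fun k => (w ^ k - (w⁻¹) ^ k) / z ^ (k + 1)) =
      PowerSeries.C w⁻¹ * (PowerSeries.mk fun k => ((z * w⁻¹)⁻¹) ^ (k + 1)) -
      PowerSeries.C w * (PowerSeries.mk fun k => ((z * w)⁻¹) ^ (k + 1)) := by
    ext k
    simp only [PowerSeries.coeff_mk, map_sub, PowerSeries.coeff_C_mul, mul_inv, inv_inv, mul_pow, inv_pow,
      div_eq_mul_inv]
    field_simp
    ring
  have h₃ : PowerSeries.C w * PowerSeries.C w⁻¹ = 1 := by
    rw [← map_mul, mul_inv_cancel₀ hw, map_one]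
  rw [h]
  simp only [map_sub, map_mul] at h₁ h₂ ⊢
  linear_combination PowerSeries.C w⁻¹ * (PowerSeries.X - PowerSeries.C z * PowerSeries.C w) * h₁ -
    PowerSeries.C w * (PowerSeries.X - PowerSeries.C z * PowerSeries.C w⁻¹) * h₂

/-- The degree-`M + n` part of a product of series `∑ (w ^ k - w⁻¹ ^ k) / z ^ (k + 1)`, expanded by
partial fractions at the poles `z i * w⁻¹` and `z i * w`. -/
theorem sum_prod_pow_sub_inv_pow {K : Type*} [Field K] {n : ℕ} (hn : 1 ≤ n) {w : K} (hw : w ≠ 0)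
    (hw2 : w ^ 2 ≠ 1) {z : Fin n → K} (hz : ∀ i, z i ≠ 0) (hinj : Function.Injective z)
    (hgen : ∀ i j, i ≠ j → w ^ 2 * z i ≠ z j) (M : ℕ) :
    ∑ k ∈ Finset.filter (fun k => ∑ i, k i = M + n)
          (Fintype.piFinset fun _ : Fin n => Finset.range (M + n + 1)),
        ∏ i, (w ^ k i - (w⁻¹) ^ k i) / z i ^ (k i + 1) =
      (w - w⁻¹) ^ n / (w - w⁻¹) * ∑ i,
        (w ^ (M + 1) / ∏ j ∈ univ.erase i, ((z i - z j) * ((w ^ 2)⁻¹ * z i - z j)) -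
          (w ^ (M + 1))⁻¹ / ∏ j ∈ univ.erase i, ((z i - z j) * (w ^ 2 * z i - z j))) /
        z i ^ (M + 2) := by
  have : Nonempty (Fin n) := ⟨⟨0, hn⟩⟩
  let y : Fin n ⊕ Fin n → K := Sum.elim (fun i => z i * w⁻¹) (fun i => z i * w)
  have hy : ∀ a, y a ≠ 0 := by
    rintro (i | i)
    · exact mul_ne_zero (hz i) (inv_ne_zero hw)
    · exact mul_ne_zero (hz i) hw
  have hne : ∀ i j, z i * w⁻¹ ≠ z j * w := by
    intro i j h
    have h' : w ^ 2 * z j = z i := by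
      field_simp at h
      rw [h]
    by_cases hij : j = i
    · subst hij
      exact hw2 (mul_right_cancel₀ (hz j) (by rw [h', one_mul]))
    · exact hgen j i hij h'
  have hyinj : Function.Injective y := by
    rintro (i | i) (j | j) h
    · exact congrArg _ (hinj (mul_right_cancel₀ (inv_ne_zero hw) h))
    · exact absurd h (hne i j)
    · exact absurd h.symm (hne j i)
    · exact congrArg _ (hinj (mul_right_cancel₀ hw h))
  have hG := PowerSeries.sum_partialFractions_mul_prod hy hyinj
  set G := ∑ a, PowerSeries.C (-∏ b ∈ univ.erase a, (y a - y b)⁻¹) *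
        PowerSeries.mk fun k => ((y a)⁻¹) ^ (k + 1) with hGdef
  have hF : ∏ i, (PowerSeries.mk fun k => (w ^ k - (w⁻¹) ^ k) / z i ^ (k + 1)) =
      PowerSeries.C ((w - w⁻¹) ^ n) * (PowerSeries.X ^ n * G) := by
    have h : (∏ i, (PowerSeries.mk fun k => (w ^ k - (w⁻¹) ^ k) / z i ^ (k + 1))) *
        ∏ a, (PowerSeries.X - PowerSeries.C (y a)) =
        PowerSeries.C ((w - w⁻¹) ^ n) * PowerSeries.X ^ n := by
      rw [Fintype.prod_sum_type, ← Finset.prod_mul_distrib, ← Finset.prod_mul_distrib,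
        Finset.prod_congr rfl fun i (_ : i ∈ univ) => show
          (PowerSeries.mk fun k => (w ^ k - (w⁻¹) ^ k) / z i ^ (k + 1)) *
            ((PowerSeries.X - PowerSeries.C (y (Sum.inl i))) *
              (PowerSeries.X - PowerSeries.C (y (Sum.inr i)))) =
            PowerSeries.C (w - w⁻¹) * PowerSeries.X from
          PowerSeries.mk_sub_inv_mul hw (hz i)]
      simp [mul_pow]
    linear_combination G * h -
      (∏ i, PowerSeries.mk fun k => (w ^ k - (w⁻¹) ^ k) / z i ^ (k + 1)) * hG
  rw [← PowerSeries.coeff_prod_mk_fin (fun i k => (w ^ k - (w⁻¹) ^ k) / z i ^ (k + 1)), hF,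
    PowerSeries.coeff_C_mul, PowerSeries.coeff_X_pow_mul, hGdef, map_sum, Fintype.sum_sum_type,
    ← Finset.sum_add_distrib, div_mul_eq_mul_div, mul_div_assoc, Finset.sum_div]
  congr 1
  refine Finset.sum_congr rfl fun i _ => ?_
  have hl : ∏ b ∈ univ.erase (Sum.inl i), (y (Sum.inl i) - y b) =
      -((w - w⁻¹) * z i * ∏ j ∈ univ.erase i, ((z i - z j) * ((w ^ 2)⁻¹ * z i - z j))) := by
    have he : (univ.erase (Sum.inl i : Fin n ⊕ Fin n)) = (univ.erase i).disjSum univ := by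
      ext (j | j) <;> simp
    rw [he, Finset.prod_disjSum, ← Finset.mul_prod_erase univ _ (mem_univ i), mul_left_comm,
      ← Finset.prod_mul_distrib, ← neg_mul]
    congr 1
    · simp only [y, Sum.elim_inl, Sum.elim_inr]; ring
    · refine Finset.prod_congr rfl fun j _ => ?_
      simp only [y, Sum.elim_inl, Sum.elim_inr]
      field_simp
  have hr : ∏ b ∈ univ.erase (Sum.inr i), (y (Sum.inr i) - y b) =
      (w - w⁻¹) * z i * ∏ j ∈ univ.erase i, ((z i - z j) * (w ^ 2 * z i - z j)) := by
    have he : (univ.erase (Sum.inr i : Fin n ⊕ Fin n)) = univ.disjSum (univ.erase i) := by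
      ext (j | j) <;> simp
    rw [he, Finset.prod_disjSum, ← Finset.mul_prod_erase univ _ (mem_univ i), mul_assoc,
      ← Finset.prod_mul_distrib]
    congr 1
    · simp only [y, Sum.elim_inl, Sum.elim_inr]; ring
    · refine Finset.prod_congr rfl fun j _ => ?_
      simp only [y, Sum.elim_inl, Sum.elim_inr]
      field_simp
  simp only [PowerSeries.coeff_C_mul, PowerSeries.coeff_mk, Finset.prod_inv_distrib]
  rw [hl, hr]
  simp only [y, Sum.elim_inl, Sum.elim_inr]
  generalize ∏ j ∈ univ.erase i, ((z i - z j) * ((w ^ 2)⁻¹ * z i - z j)) = A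
  generalize ∏ j ∈ univ.erase i, ((z i - z j) * (w ^ 2 * z i - z j)) = B
  simp only [mul_inv, mul_pow, inv_inv, inv_neg, neg_neg, div_eq_mul_inv, inv_pow]
  ring

/-- Lemma A.2: for `r ≥ 2`, `1 ≤ α ≤ r-1`, `ζ = e^{2πi/r}`, `w = ζ^{α/2} = e^{απi/r}`,
and nonzero pairwise-distinct `z₁,…,zₙ` in generic position, the identity
`(1/πi) ∑ᵢ [ ζ^{α/2}(1-ζ^α)^{-2g}/∏_{j≠i}(zᵢ-zⱼ)(ζ^α zᵢ-zⱼ)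
            - ζ^{-α/2}(1-ζ^{-α})^{-2g}/∏_{j≠i}(zᵢ-zⱼ)(ζ^{-α} zᵢ-zⱼ) ] zᵢ^{-(r+1)(2g-2+n)+n-2}
 = (-1)^{g-1+αn} · 2ⁿ/(2π sin(απ/r)) · (2 sin(απ/r))^{-(2g-2+n)}
   · ∑_{|k|=(r+1)(2g-2+n)} ∏ᵢ sin(αkᵢπ/r)/zᵢ^{kᵢ+1}` holds. -/
theorem rspin_cyclic_identity (r α n g : ℕ) (hr : 2 ≤ r) (hα : 1 ≤ α) (hαr : α ≤ r - 1)
    (hn : 1 ≤ n) (hg : 1 ≤ g) (z : Fin n → ℂ) (hz0 : ∀ i, z i ≠ 0)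
    (ζ w : ℂ)
    (hζ : ζ = Complex.exp (2 * Real.pi * Complex.I / r))
    (hw : w = Complex.exp ((α : ℂ) * Real.pi * Complex.I / r))
    (hinj : Function.Injective z)
    (hgen : ∀ i j : Fin n, i ≠ j → ζ ^ α * z i ≠ z j) :
    ((Real.pi : ℂ) * Complex.I)⁻¹ *
      ∑ i : Fin n,
        ((w * ((1 - ζ ^ α) ^ (2 * g))⁻¹ /
            ∏ j ∈ Finset.univ.erase i, ((z i - z j) * (ζ ^ α * z i - z j))
          - w⁻¹ * ((1 - (ζ ^ α)⁻¹) ^ (2 * g))⁻¹ /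
            ∏ j ∈ Finset.univ.erase i, ((z i - z j) * ((ζ ^ α)⁻¹ * z i - z j)))
          * z i ^ ((n : ℤ) - 2 - (((r + 1) * (2 * g - 2 + n) : ℕ) : ℤ)))
    = (-1) ^ (g - 1 + α * n) * 2 ^ n /
        (2 * (Real.pi : ℂ) * ((Real.sin (α * Real.pi / r) : ℝ) : ℂ)) *
      ((((2 * Real.sin (α * Real.pi / r)) ^ (2 * g - 2 + n) : ℝ) : ℂ))⁻¹ *
      ∑ k ∈ Finset.filter (fun k => ∑ i, k i = (r + 1) * (2 * g - 2 + n))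
          (Fintype.piFinset fun _ : Fin n => Finset.range ((r + 1) * (2 * g - 2 + n) + 1)),
        ∏ i : Fin n, ((Real.sin (α * k i * Real.pi / r) : ℝ) : ℂ) / z i ^ (k i + 1) := by
  obtain ⟨g, rfl⟩ := Nat.exists_eq_add_of_le' hg
  have hr0 : (r : ℂ) ≠ 0 := Nat.cast_ne_zero.2 (by omega)
  have hw0 : w ≠ 0 := hw ▸ Complex.exp_ne_zero _
  have hwζ : ζ ^ α = w ^ 2 := by
    rw [hζ, hw, ← Complex.exp_nat_mul, ← Complex.exp_nat_mul]
    congr 1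
    push_cast
    ring
  have hwr : w ^ r = (-1) ^ α := by
    rw [hw, ← Complex.exp_nat_mul, ← Complex.exp_pi_mul_I, ← Complex.exp_nat_mul]
    congr 1
    field_simp
  have hsin : ∀ k : ℕ, ((Real.sin (α * k * Real.pi / r) : ℝ) : ℂ) =
      (w ^ k - (w⁻¹) ^ k) / (2 * I) := by
    intro k
    rw [hw, ← Complex.exp_neg, ← Complex.exp_nat_mul, ← Complex.exp_nat_mul, Complex.ofReal_sin,
      Complex.sin]
    push_cast
    rw [show -((α : ℂ) * k * Real.pi / r) * I = k * -(α * Real.pi * I / r) by ring,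
      show (α : ℂ) * k * Real.pi / r * I = k * (α * Real.pi * I / r) by ring]
    field_simp
    rw [I_sq]
    ring
  have hsin1 : ((Real.sin (α * Real.pi / r) : ℝ) : ℂ) = (w - w⁻¹) / (2 * I) := by
    simpa using hsin 1
  have hd : w - w⁻¹ ≠ 0 := by
    intro h
    have hpos : 0 < Real.sin (α * Real.pi / r) := by
      have hα' : (0 : ℝ) < α := Nat.cast_pos.2 hα
      have hr' : (0 : ℝ) < r := Nat.cast_pos.2 (by omega)
      have hlt : (α : ℝ) < r := Nat.cast_lt.2 (by omega)
      apply Real.sin_pos_of_pos_of_lt_pi (by positivity)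
      rw [div_lt_iff₀ hr', mul_comm]
      exact mul_lt_mul_of_pos_left hlt Real.pi_pos
    rw [h, zero_div, Complex.ofReal_eq_zero] at hsin1
    exact hpos.ne' hsin1
  have hw2 : w ^ 2 ≠ 1 := by
    intro h
    apply hd
    field_simp
    rw [h, sub_self, mul_zero]
  rw [hwζ] at hgen ⊢
  obtain ⟨M, hM⟩ : ∃ M, M = r * (2 * g + n) + 2 * g := ⟨_, rfl⟩
  have hN : (r + 1) * (2 * (g + 1) - 2 + n) = M + n := by
    rw [hM, show 2 * (g + 1) - 2 + n = 2 * g + n by omega]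
    ring
  have hwM : w ^ (M + 1) = (-1) ^ (α * n) * w ^ (2 * g + 1) := by
    rw [hM, add_assoc, pow_add, pow_mul, hwr, pow_add, ← pow_mul, ← pow_mul, mul_left_comm,
      pow_mul (-1 : ℂ) 2]
    simp
  have hsum : ∀ k : Fin n → ℕ,
      ∏ i, ((Real.sin (α * k i * Real.pi / r) : ℝ) : ℂ) / z i ^ (k i + 1) =
        ((2 * I) ^ n)⁻¹ * ∏ i, (w ^ k i - (w⁻¹) ^ k i) / z i ^ (k i + 1) := by
    intro k
    rw [Finset.prod_congr rfl fun i _ => show _ = (2 * I)⁻¹ *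
      ((w ^ k i - (w⁻¹) ^ k i) / z i ^ (k i + 1)) by rw [hsin]; ring, Finset.prod_mul_distrib,
      Finset.prod_const, Finset.card_univ, Fintype.card_fin, inv_pow]
  rw [hN, Finset.sum_congr rfl fun k _ => hsum k, ← Finset.mul_sum,
    sum_prod_pow_sub_inv_pow hn hw0 hw2 hz0 hinj hgen M, hwM]
  have hterm : ∀ i, (w * ((1 - w ^ 2) ^ (2 * (g + 1)))⁻¹ /
            ∏ j ∈ univ.erase i, ((z i - z j) * (w ^ 2 * z i - z j))
          - w⁻¹ * ((1 - (w ^ 2)⁻¹) ^ (2 * (g + 1)))⁻¹ /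
            ∏ j ∈ univ.erase i, ((z i - z j) * ((w ^ 2)⁻¹ * z i - z j)))
          * z i ^ ((n : ℤ) - 2 - ((M + n : ℕ) : ℤ)) =
        (-((w - w⁻¹) ^ (2 * g + 2))⁻¹ * (-1) ^ (α * n)) *
        (((-1) ^ (α * n) * w ^ (2 * g + 1) /
          ∏ j ∈ univ.erase i, ((z i - z j) * ((w ^ 2)⁻¹ * z i - z j)) -
          ((-1) ^ (α * n) * w ^ (2 * g + 1))⁻¹ /
            ∏ j ∈ univ.erase i, ((z i - z j) * (w ^ 2 * z i - z j))) / z i ^ (M + 2)) := by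
    intro i
    generalize ∏ j ∈ univ.erase i, ((z i - z j) * ((w ^ 2)⁻¹ * z i - z j)) = A
    generalize ∏ j ∈ univ.erase i, ((z i - z j) * (w ^ 2 * z i - z j)) = B
    have hz : z i ^ ((n : ℤ) - 2 - ((M + n : ℕ) : ℤ)) = (z i ^ (M + 2))⁻¹ := by
      rw [← zpow_natCast, ← zpow_neg]
      congr 1
      push_cast
      ring
    have h₁ : (1 - w ^ 2) ^ (2 * (g + 1)) = w ^ (2 * g + 2) * (w - w⁻¹) ^ (2 * g + 2) := by
      rw [← mul_pow, show w * (w - w⁻¹) = -(1 - w ^ 2) by field_simp; ring,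
        Even.neg_pow ⟨g + 1, by ring⟩, mul_add, mul_one]
    have h₂ : (1 - (w ^ 2)⁻¹) ^ (2 * (g + 1)) = (w⁻¹) ^ (2 * g + 2) * (w - w⁻¹) ^ (2 * g + 2) := by
      rw [← mul_pow, mul_sub, inv_mul_cancel₀ hw0, ← sq, inv_pow, mul_add, mul_one]
    have hε : ((-1 : ℂ) ^ (α * n))⁻¹ = (-1) ^ (α * n) := by
      rw [← inv_pow, inv_neg, inv_one]
    have hεε : (-1 : ℂ) ^ (α * n) * (-1) ^ (α * n) = 1 := by
      rw [← mul_pow]; simp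
    have hw₁ : w * (w ^ (2 * g + 2))⁻¹ = (w ^ (2 * g + 1))⁻¹ := by
      field_simp
      ring
    have hw₂ : w⁻¹ * ((w⁻¹) ^ (2 * g + 2))⁻¹ = w ^ (2 * g + 1) := by
      rw [inv_pow, inv_inv]
      field_simp
      ring
    rw [hz, h₁, h₂, mul_inv, mul_inv, ← mul_assoc, ← mul_assoc, hw₁, hw₂, mul_inv, hε]
    generalize (-1 : ℂ) ^ (α * n) = ε at hεε
    linear_combination (((w ^ (2 * g + 1) / A - (w ^ (2 * g + 1))⁻¹ / B) *
      ((w - w⁻¹) ^ (2 * g + 2))⁻¹) / z i ^ (M + 2)) * hεε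
  rw [Finset.sum_congr rfl fun i _ => hterm i, ← Finset.mul_sum]
  have hconst : ((Real.pi : ℂ) * I)⁻¹ * (-((w - w⁻¹) ^ (2 * g + 2))⁻¹ * (-1) ^ (α * n)) =
      (-1) ^ (g + 1 - 1 + α * n) * 2 ^ n /
        (2 * (Real.pi : ℂ) * ((Real.sin (α * Real.pi / r) : ℝ) : ℂ)) *
      ((((2 * Real.sin (α * Real.pi / r)) ^ (2 * (g + 1) - 2 + n) : ℝ) : ℂ))⁻¹ *
      (((2 * I) ^ n)⁻¹ * ((w - w⁻¹) ^ n / (w - w⁻¹))) := by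
    have hpi : (Real.pi : ℂ) ≠ 0 := Complex.ofReal_ne_zero.2 Real.pi_ne_zero
    have hI : I ^ (2 * g) = (-1) ^ g := by rw [pow_mul, I_sq]
    rw [show 2 * (g + 1) - 2 + n = 2 * g + n by omega, Nat.add_sub_cancel, Complex.ofReal_pow,
      Complex.ofReal_mul, hsin1, Complex.ofReal_ofNat,
      show 2 * ((w - w⁻¹) / (2 * I)) = (w - w⁻¹) / I by field_simp]
    generalize w - w⁻¹ = d at hd
    rw [div_pow, pow_add I, hI, pow_add (-1 : ℂ), mul_pow]
    generalize (-1 : ℂ) ^ (α * n) = ε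
    have hgg : (-1 : ℂ) ^ g * (-1) ^ g = 1 := by rw [← mul_pow]; simp
    field_simp
    rw [I_sq, sq ((-1 : ℂ) ^ g), hgg]
    ring
  linear_combination (∑ i, (((-1) ^ (α * n) * w ^ (2 * g + 1) /
          ∏ j ∈ univ.erase i, ((z i - z j) * ((w ^ 2)⁻¹ * z i - z j)) -
          ((-1) ^ (α * n) * w ^ (2 * g + 1))⁻¹ /
            ∏ j ∈ univ.erase i, ((z i - z j) * (w ^ 2 * z i - z j))) / z i ^ (M + 2))) * hconst
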